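/- For all integers n ≥ 1 and m ≥ 1, the largest singular value of the matrix R (equivalently, its Euclidean operator norm ‖R‖₂) satisfies ‖R‖₂ ≤ n + m + 3/2. -/

import Mathlib

open Real Finset

/-- `d_ℓ^m` from the Cholesky factor `R`. -/
noncomputable def dd (ℓ m : ℕ) : ℝ :=
  ((ℓ : ℝ) + m - 1) * Real.sqrt (((ℓ : ℝ) + m + 1) * ((ℓ : ℝ) + 2 * m) * ((ℓ : ℝ) + 2 * m + 1) /
    (((ℓ : ℝ) + m) * (2 * (ℓ : ℝ) + 2 * m - 1) * (2 * (ℓ : ℝ) + 2 * m + 1)))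

/-- `e_ℓ^m` from the Cholesky factor `R`. -/
noncomputable def ee (ℓ m : ℕ) : ℝ :=
  Real.sqrt ((ℓ : ℝ) * ((ℓ : ℝ) + 2 * m + 1) / (((ℓ : ℝ) + m) * ((ℓ : ℝ) + m + 1)))

/-- `f_ℓ^m` from the Cholesky factor `R`. -/
noncomputable def ff (ℓ m : ℕ) : ℝ :=
  ((ℓ : ℝ) + m + 2) * Real.sqrt ((ℓ : ℝ) * ((ℓ : ℝ) + 1) * ((ℓ : ℝ) + m) /
    (((ℓ : ℝ) + m + 1) * (2 * (ℓ : ℝ) + 2 * m + 1) * (2 * (ℓ : ℝ) + 2 * m + 3)))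

/-- The `n × n` upper-triangular banded matrix `R` with diagonal `d`, superdiagonal `-e`,
second superdiagonal `-f` (1-based indices shifted to 0-based `Fin n`). -/
noncomputable def Rmat (n m : ℕ) : Matrix (Fin n) (Fin n) ℝ :=
  Matrix.of fun i j : Fin n =>
    if (j : ℕ) = (i : ℕ) then dd ((i : ℕ) + 1) m
    else if (j : ℕ) = (i : ℕ) + 1 then -ee ((i : ℕ) + 1) m
    else if (j : ℕ) = (i : ℕ) + 2 then -ff ((i : ℕ) + 1) m
    else 0

/-- The operator norm on square real matrices induced by the Euclidean norm on `ℝⁿ`. -/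
noncomputable def opNorm2 {n : ℕ} (A : Matrix (Fin n) (Fin n) ℝ) : ℝ :=
  ‖Matrix.toEuclideanCLM (𝕜 := ℝ) A‖

/-- **Schur test**: if all absolute row and column sums of `A` are at most `C`, then so is its
Euclidean operator norm. -/
lemma opNorm2_le_of_sum_abs_le {n : ℕ} (A : Matrix (Fin n) (Fin n) ℝ) {C : ℝ} (hC : 0 ≤ C)
    (hrow : ∀ i, ∑ j, |A i j| ≤ C) (hcol : ∀ j, ∑ i, |A i j| ≤ C) : opNorm2 A ≤ C := by
  refine ContinuousLinearMap.opNorm_le_bound _ hC fun x => ?_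
  refine (sq_le_sq₀ (norm_nonneg _) (by positivity)).1 ?_
  rw [mul_pow, EuclideanSpace.real_norm_sq_eq, EuclideanSpace.real_norm_sq_eq]
  have hentry : ∀ i, (Matrix.toEuclideanCLM (𝕜 := ℝ) A x) i ^ 2
      ≤ C * ∑ j, |A i j| * x j ^ 2 := by
    intro i
    have happ : (Matrix.toEuclideanCLM (𝕜 := ℝ) A x) i = ∑ j, A i j * x j := by
      simp [Matrix.mulVec, dotProduct]
    rw [happ]
    have hcs : (∑ j, A i j * x j) ^ 2 ≤ (∑ j, |A i j|) * ∑ j, |A i j| * x j ^ 2 := by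
      refine Finset.sum_sq_le_sum_mul_sum_of_sq_le_mul _ (fun j _ => abs_nonneg _)
        (fun j _ => by positivity) fun j _ => ?_
      rw [mul_pow, ← sq_abs (A i j)]
      exact le_of_eq (by ring)
    exact hcs.trans (mul_le_mul_of_nonneg_right (hrow i)
      (Finset.sum_nonneg fun j _ => by positivity))
  calc ∑ i, (Matrix.toEuclideanCLM (𝕜 := ℝ) A x) i ^ 2
      ≤ ∑ i, C * ∑ j, |A i j| * x j ^ 2 := Finset.sum_le_sum fun i _ => hentry i
    _ = C * ∑ j, (∑ i, |A i j|) * x j ^ 2 := by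
      rw [← Finset.mul_sum, Finset.sum_comm]
      simp only [Finset.sum_mul]
    _ ≤ C * ∑ j, C * x j ^ 2 := by
      gcongr with j
      exact hcol j
    _ = C ^ 2 * ∑ j, x j ^ 2 := by
      rw [← Finset.mul_sum]
      ring

lemma dd_nonneg {ℓ m : ℕ} (hm : 1 ≤ m) : 0 ≤ dd ℓ m := by
  have h1 : (1 : ℝ) ≤ m := by exact_mod_cast hm
  have h2 : (0 : ℝ) ≤ ℓ := ℓ.cast_nonneg
  exact mul_nonneg (by linarith) (Real.sqrt_nonneg _)

lemma dd_le {ℓ m : ℕ} (hm : 1 ≤ m) : dd ℓ m ≤ (ℓ : ℝ) / 2 + m + 1 / 4 := by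
  have h1 : (1 : ℝ) ≤ m := by exact_mod_cast hm
  have h2 : (0 : ℝ) ≤ ℓ := ℓ.cast_nonneg
  refine abs_le_of_sq_le_sq' ?_ (by positivity) |>.2
  have hs : (0 : ℝ) < 2 * ℓ + 2 * m - 1 := by linarith
  rw [dd, mul_pow, Real.sq_sqrt (by positivity), mul_div_assoc', div_le_iff₀ (by positivity)]
  obtain ⟨s, hsm⟩ : ∃ s, s = (ℓ : ℝ) + m := ⟨_, rfl⟩
  have hl : (ℓ : ℝ) = s - m := by linarith
  have hs1 : 1 ≤ s := by linarith
  rw [hl]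
  have key : (s - 1) ^ 2 * (s + 1) ≤ s * (s ^ 2 - 1 / 4) := by nlinarith
  have key2 : (s + m) * (s + m + 1) ≤ (s + m + 1 / 2) ^ 2 := by nlinarith
  have := mul_le_mul key key2 (by positivity) (by nlinarith)
  nlinarith

lemma ee_le_one {ℓ m : ℕ} : ee ℓ m ≤ 1 := by
  refine Real.sqrt_le_one.2 (div_le_one_of_le₀ ?_ (by positivity))
  have h1 : (0 : ℝ) ≤ m := m.cast_nonneg
  nlinarith

lemma ff_nonneg {ℓ m : ℕ} : 0 ≤ ff ℓ m := by
  unfold ff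
  positivity

lemma ff_le {ℓ m : ℕ} (hm : 1 ≤ m) : ff ℓ m ≤ (ℓ : ℝ) / 2 + 3 / 4 := by
  have h1 : (1 : ℝ) ≤ m := by exact_mod_cast hm
  have h2 : (0 : ℝ) ≤ ℓ := ℓ.cast_nonneg
  refine abs_le_of_sq_le_sq' ?_ (by positivity) |>.2
  rw [ff, mul_pow, Real.sq_sqrt (by positivity), mul_div_assoc', div_le_iff₀ (by positivity)]
  obtain ⟨s, hs⟩ : ∃ s, s = (ℓ : ℝ) + m := ⟨_, rfl⟩
  have hsl : (ℓ : ℝ) + 1 ≤ s := by linarith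
  have key : (s + 2) * s ^ 2 ≤ (s + 1) * ((s + 1 / 2) * (s + 3 / 2)) := by nlinarith
  have key2 : (s + 2) * (ℓ * (ℓ + 1)) ≤ s * ((ℓ : ℝ) + 3 / 2) ^ 2 := by nlinarith
  have hs0 : 0 < s := by linarith
  have hmul := mul_le_mul key key2 (by positivity) (by positivity)
  refine le_of_mul_le_mul_left (a := s) ?_ hs0
  rw [show (2 : ℝ) * ℓ + 2 * m + 1 = 2 * s + 1 by rw [hs]; ring,
    show (2 : ℝ) * ℓ + 2 * m + 3 = 2 * s + 3 by rw [hs]; ring, ← hs]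
  linarith

lemma sum_ite_le_of_subsingleton {ι : Type*} [Fintype ι] (p : ι → Prop) [DecidablePred p] {c : ℝ}
    (hc : 0 ≤ c) (hp : ∀ i j, p i → p j → i = j) : ∑ i, (if p i then c else 0) ≤ c := by
  rw [← Finset.sum_filter, Finset.sum_const, nsmul_eq_mul]
  have hcard : #{i | p i} ≤ 1 := Finset.card_le_one.2 fun i hi j hj =>
    hp i j (Finset.mem_filter.1 hi).2 (Finset.mem_filter.1 hj).2
  exact mul_le_of_le_one_left hc (by exact_mod_cast hcard)

lemma abs_Rmat_le {n m : ℕ} (hm : 1 ≤ m) (i j : Fin n) :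
    |Rmat n m i j| ≤ (if (j : ℕ) = i then (n : ℝ) / 2 + m + 1 / 4 else 0) +
      (if (j : ℕ) = i + 1 then 1 else 0) + (if (j : ℕ) = i + 2 then (n : ℝ) / 2 - 1 / 4 else 0) := by
  rw [Rmat, Matrix.of_apply]
  by_cases h0 : (j : ℕ) = i
  · have hi : (((i : ℕ) + 1 : ℕ) : ℝ) ≤ n := by exact_mod_cast i.2
    simp only [h0, if_true, abs_of_nonneg (dd_nonneg hm)]
    have := dd_le (ℓ := (i : ℕ) + 1) hm
    simp
    linarith
  by_cases h1 : (j : ℕ) = i + 1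
  · simpa [h1, abs_of_nonneg (show 0 ≤ ee (i + 1) m from Real.sqrt_nonneg _)] using ee_le_one
  by_cases h2 : (j : ℕ) = i + 2
  · have hi : (((i : ℕ) + 1 : ℕ) : ℝ) + 2 ≤ n := by
      have := j.2
      exact_mod_cast (by omega : (i : ℕ) + 1 + 2 ≤ n)
    have hf := ff_le (ℓ := (i : ℕ) + 1) hm
    simp [h2, abs_of_nonneg ff_nonneg]
    linarith
  · simp [h0, h1, h2]

theorem stmt18 (n m : ℕ) (hn : 1 ≤ n) (hm : 1 ≤ m) :
    opNorm2 (Rmat n m) ≤ (n : ℝ) + m + 3 / 2 := by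
  have hn' : (1 : ℝ) ≤ n := by exact_mod_cast hn
  have hd : (0 : ℝ) ≤ (n : ℝ) / 2 + m + 1 / 4 := by positivity
  have hf : (0 : ℝ) ≤ (n : ℝ) / 2 - 1 / 4 := by linarith
  refine opNorm2_le_of_sum_abs_le _ (by positivity) (fun i => ?_) fun j => ?_
  · refine (Finset.sum_le_sum fun j _ => abs_Rmat_le hm i j).trans ?_
    rw [Finset.sum_add_distrib, Finset.sum_add_distrib]
    have h0 := sum_ite_le_of_subsingleton (fun j : Fin n => (j : ℕ) = i) hd (by grind)
    have h1 := sum_ite_le_of_subsingleton (fun j : Fin n => (j : ℕ) = i + 1) zero_le_one (by grind)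
    have h2 := sum_ite_le_of_subsingleton (fun j : Fin n => (j : ℕ) = i + 2) hf (by grind)
    linarith
  · refine (Finset.sum_le_sum fun i _ => abs_Rmat_le hm i j).trans ?_
    rw [Finset.sum_add_distrib, Finset.sum_add_distrib]
    have h0 := sum_ite_le_of_subsingleton (fun i : Fin n => (j : ℕ) = i) hd (by grind)
    have h1 := sum_ite_le_of_subsingleton (fun i : Fin n => (j : ℕ) = i + 1) zero_le_one (by grind)
    have h2 := sum_ite_le_of_subsingleton (fun i : Fin n => (j : ℕ) = i + 2) hf (by grind)
    linarith
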